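/- Let X ∈ ℝ^{n×p} be a design matrix, x ∈ ℝ^n a response vector, θ̃* ∈ ℝ^p a target vector, and J ⊆ {1,…,p} with |J| ≤ k (k ≥ 1); write b := ‖θ̃*_{J^c}‖₁. Suppose Σ̂ = XᵀX/n satisfies the restricted eigenvalue condition RE(α, τ) with curvature α > 0 and tolerance τ = ((m−1)/m)·α/(32k) for some m > 1, and that ‖(1/n)·Xᵀ(x − Xθ̃*)‖_∞ ≤ λ/4 for some λ > 0. Then any minimizer θ̂ of the LASSO objective (1/n)‖x − Xθ‖₂² + λ‖θ‖₁ satisfies |ℓ(θ̂) − ℓ(θ̃*)| ≤ 20·k·λ²/(α/m) + (8√(2m) + 18)·λ·b, where ℓ(θ) := (1/n)‖x − Xθ‖₂². -/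

import Mathlib

open Matrix Finset

/-- The ℓ₁ norm of a finite-dimensional real vector. -/
noncomputable def l1norm {d : ℕ} (v : Fin d → ℝ) : ℝ := ∑ i, |v i|

/-- The Euclidean (ℓ₂) norm of a finite-dimensional real vector. -/
noncomputable def l2norm {d : ℕ} (v : Fin d → ℝ) : ℝ := Real.sqrt (∑ i, (v i) ^ 2)

/-- The empirical loss ℓ(θ) = (1/n)‖x − Xθ‖₂². -/
noncomputable def empLoss {n d : ℕ} (X : Matrix (Fin n) (Fin d) ℝ) (x : Fin n → ℝ)
    (θ : Fin d → ℝ) : ℝ := (1 / (n : ℝ)) * (l2norm (x - X *ᵥ θ)) ^ 2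

theorem l2norm_sq_eq {d : ℕ} (v : Fin d → ℝ) : (l2norm v) ^ 2 = v ⬝ᵥ v := by
  unfold l2norm
  rw [Real.sq_sqrt (Finset.sum_nonneg fun i _ => sq_nonneg _)]
  simp [dotProduct, sq]

theorem lasso_scalar {u b c m : ℝ} (hu : 0 ≤ u) (hb : 0 ≤ b) (hc : 0 ≤ c) (hm : 1 < m)
    (h : u ^ 2 ≤ 3 / 2 * c * u + 2 * c * b + (m - 1) * b ^ 2) :
    u ≤ 10 * c + (4 * Real.sqrt (2 * m) + 8) * b := by
  have hs0 : 0 ≤ Real.sqrt (2 * m) := Real.sqrt_nonneg _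
  have hs : Real.sqrt (2 * m) ^ 2 = 2 * m := Real.sq_sqrt (by linarith)
  generalize Real.sqrt (2 * m) = s at *
  by_contra! hlt
  have hm' : m = s ^ 2 / 2 := by linarith
  subst hm'
  have hsb : 0 ≤ s * b := mul_nonneg hs0 hb
  have hw : 0 < u - (10 * c + (4 * s + 8) * b) := by linarith
  obtain ⟨w, hwe⟩ : ∃ w, w = u - (10 * c + (4 * s + 8) * b) := ⟨_, rfl⟩
  rw [← hwe] at hw
  have hue : u = w + 10 * c + 4 * (s * b) + 8 * b := by rw [hwe]; ring
  have hsb2 : (s ^ 2 / 2 - 1) * b ^ 2 = (s * b) ^ 2 / 2 - b ^ 2 := by ring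
  rw [hsb2, hue] at h
  generalize s * b = t at *
  have := mul_nonneg hc hb
  have := mul_nonneg hc hsb
  have := mul_nonneg hc hw.le
  have := mul_nonneg hb hsb
  have := mul_nonneg hb hw.le
  have := mul_nonneg hsb hw.le
  have := mul_pos hw hw
  have := sq_nonneg c
  have := sq_nonneg b
  have := sq_nonneg t
  nlinarith

/-- Proposition 2: deviation result for the reduced model.  For a weakly sparse
target `θtil` with support set `J` (|J| ≤ k) and b = ‖θtil_{Jᶜ}‖₁, any LASSO
minimizer θ̂ satisfies |ℓ(θ̂) − ℓ(θ̃*)| ≤ 20kλ²/(α/m) + (8√(2m)+18)·λ·b. -/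
theorem lasso_deviation_reduced_model
    {n p k : ℕ} (hn : 0 < n) (hk : 1 ≤ k)
    (X : Matrix (Fin n) (Fin p) ℝ) (x : Fin n → ℝ)
    (θtil θhat : Fin p → ℝ)
    (J : Finset (Fin p)) (hJ : J.card ≤ k)
    (α m lam : ℝ) (hα : 0 < α) (hm : 1 < m) (hlam : 0 < lam)
    -- restricted eigenvalue condition RE(α, τ) for Σ̂ = XᵀX/n
    (hRE : ∀ φ : Fin p → ℝ,
      φ ⬝ᵥ (((1 / (n : ℝ)) • (Xᵀ * X)) *ᵥ φ) ≥
        α * (l2norm φ) ^ 2 - ((m - 1) / m * (α / (32 * k))) * (l1norm φ) ^ 2)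
    -- deviation bound: ‖(1/n)·Xᵀ(x − Xθ̃*)‖_∞ ≤ λ/4
    (hdev : ∀ i : Fin p, |(1 / (n : ℝ)) * (Xᵀ *ᵥ (x - X *ᵥ θtil)) i| ≤ lam / 4)
    -- θ̂ minimizes the LASSO objective
    (hmin : ∀ θ : Fin p → ℝ,
      empLoss X x θhat + lam * l1norm θhat ≤ empLoss X x θ + lam * l1norm θ) :
    |empLoss X x θhat - empLoss X x θtil| ≤
      20 * (k * lam ^ 2) / (α / m)
        + (8 * Real.sqrt (2 * m) + 18) * lam * (∑ i ∈ Jᶜ, |θtil i|) := by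
  have hn' : (0 : ℝ) < 1 / (n : ℝ) := by positivity
  have hk' : (0 : ℝ) < (k : ℝ) := by exact_mod_cast hk
  obtain ⟨Δ, hΔ⟩ : ∃ Δ, Δ = θhat - θtil := ⟨_, rfl⟩
  have hhat : θhat = θtil + Δ := by rw [hΔ]; abel
  obtain ⟨r, hr⟩ : ∃ r, r = x - X *ᵥ θtil := ⟨_, rfl⟩
  obtain ⟨Q, hQ⟩ : ∃ Q, Q = (1 / (n : ℝ)) * ((X *ᵥ Δ) ⬝ᵥ (X *ᵥ Δ)) := ⟨_, rfl⟩
  obtain ⟨G, hG⟩ : ∃ G, G = (1 / (n : ℝ)) * ((Xᵀ *ᵥ r) ⬝ᵥ Δ) := ⟨_, rfl⟩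
  have hQ0 : 0 ≤ Q := by
    rw [hQ, ← l2norm_sq_eq]; positivity
  have hrw : r ⬝ᵥ (X *ᵥ Δ) = (Xᵀ *ᵥ r) ⬝ᵥ Δ := by
    rw [Matrix.dotProduct_mulVec, Matrix.mulVec_transpose]
  have hdiff : empLoss X x θhat - empLoss X x θtil = Q - 2 * G := by
    unfold empLoss
    have h1 : x - X *ᵥ θhat = r - X *ᵥ Δ := by
      rw [hhat, hr, Matrix.mulVec_add]; abel
    rw [h1, ← hr, l2norm_sq_eq, l2norm_sq_eq, sub_dotProduct, dotProduct_sub, dotProduct_sub,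
      dotProduct_comm (X *ᵥ Δ) r, hrw, hQ, hG]
    ring
  obtain ⟨u, hu⟩ : ∃ u, u = ∑ i ∈ J, |Δ i| := ⟨_, rfl⟩
  obtain ⟨v, hv⟩ : ∃ v, v = ∑ i ∈ Jᶜ, |Δ i| := ⟨_, rfl⟩
  obtain ⟨b, hb⟩ : ∃ b, b = ∑ i ∈ Jᶜ, |θtil i| := ⟨_, rfl⟩
  have hu0 : 0 ≤ u := by rw [hu]; positivity
  have hv0 : 0 ≤ v := by rw [hv]; positivity
  have hb0 : 0 ≤ b := by rw [hb]; positivity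
  have hl1 : l1norm Δ = u + v := by
    rw [hu, hv, l1norm, Finset.sum_add_sum_compl]
  have hGle : |G| ≤ lam / 4 * (u + v) := by
    rw [hG, ← hl1, l1norm, dotProduct, Finset.mul_sum, Finset.mul_sum]
    refine (Finset.abs_sum_le_sum_abs _ _).trans (Finset.sum_le_sum fun i _ => ?_)
    rw [← mul_assoc, abs_mul]
    have := hdev i
    rw [← hr] at this
    exact mul_le_mul_of_nonneg_right this (abs_nonneg _)
  have hl1d : l1norm θtil - l1norm θhat ≤ u - v + 2 * b := by
    have e1 : l1norm θtil = ∑ i ∈ J, |θtil i| + b := by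
      rw [hb, l1norm, Finset.sum_add_sum_compl]
    have e2 : l1norm θhat = ∑ i ∈ J, |θhat i| + ∑ i ∈ Jᶜ, |θhat i| := by
      rw [l1norm, Finset.sum_add_sum_compl]
    have e3 : ∑ i ∈ J, |θtil i| ≤ ∑ i ∈ J, |θhat i| + u := by
      rw [hu, ← Finset.sum_add_distrib]
      refine Finset.sum_le_sum fun i _ => ?_
      have := abs_sub (θhat i) (Δ i)
      rwa [show θhat i - Δ i = θtil i by rw [hΔ]; simp] at this
    have e4 : v ≤ ∑ i ∈ Jᶜ, |θhat i| + b := by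
      rw [hv, hb, ← Finset.sum_add_distrib]
      refine Finset.sum_le_sum fun i _ => ?_
      have := abs_sub (θhat i) (θtil i)
      rwa [show θhat i - θtil i = Δ i by rw [hΔ]; simp] at this
    linarith
  have hbasic : Q - 2 * G ≤ lam * (u - v + 2 * b) := by
    have h1 := hmin θtil
    have h2 := mul_le_mul_of_nonneg_left hl1d hlam.le
    linarith
  obtain ⟨hG1, hG2⟩ := abs_le.mp hGle
  have hcone : v ≤ 3 * u + 4 * b := by
    have : 0 ≤ lam * (3 * u + 4 * b - v) := by nlinarith
    have := nonneg_of_mul_nonneg_right this hlam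
    linarith
  have hQup : Q ≤ lam * (3 / 2 * u + 2 * b) := by nlinarith [mul_nonneg hlam.le hv0]
  have hQRE : Q ≥ α * (l2norm Δ) ^ 2 - ((m - 1) / m * (α / (32 * k))) * (u + v) ^ 2 := by
    have := hRE Δ
    rw [hl1] at this
    have e : Δ ⬝ᵥ (((1 / (n : ℝ)) • (Xᵀ * X)) *ᵥ Δ) = Q := by
      rw [Matrix.smul_mulVec, dotProduct_smul, ← Matrix.mulVec_mulVec, smul_eq_mul, hQ,
        Matrix.dotProduct_mulVec, Matrix.vecMul_transpose]
    rwa [e] at this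
  have huD : u ^ 2 ≤ k * (l2norm Δ) ^ 2 := by
    have h1 : u ^ 2 ≤ J.card * ∑ i ∈ J, |Δ i| ^ 2 := by
      rw [hu]; exact sq_sum_le_card_mul_sum_sq
    have h2 : ∑ i ∈ J, |Δ i| ^ 2 ≤ (l2norm Δ) ^ 2 := by
      unfold l2norm
      rw [Real.sq_sqrt (Finset.sum_nonneg fun i _ => sq_nonneg _)]
      simp only [sq_abs]
      exact Finset.sum_le_sum_of_subset_of_nonneg (Finset.subset_univ _)
        fun i _ _ => sq_nonneg _
    refine h1.trans (mul_le_mul (by exact_mod_cast hJ) h2 (by positivity) hk'.le)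
  have hm0 : 0 < m := by linarith
  have huv : (u + v) ^ 2 ≤ 32 * (k * (l2norm Δ) ^ 2 + b ^ 2) := by
    have : (u + v) ^ 2 ≤ (4 * u + 4 * b) ^ 2 :=
      pow_le_pow_left₀ (by linarith) (by linarith) 2
    nlinarith [sq_nonneg (u - b)]
  have hτ : 0 ≤ (m - 1) / m * (α / (32 * k)) := by
    have : 0 ≤ m - 1 := by linarith
    positivity
  have hQlow : α / m * (l2norm Δ) ^ 2 - (m - 1) * (α / m) / k * b ^ 2 ≤ Q := by
    have h1 := mul_le_mul_of_nonneg_left huv hτ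
    have h2 : (m - 1) / m * (α / (32 * k)) * (32 * (k * (l2norm Δ) ^ 2 + b ^ 2))
        = α * (l2norm Δ) ^ 2 - α / m * (l2norm Δ) ^ 2 + (m - 1) * (α / m) / k * b ^ 2 := by
      field_simp
    linarith
  have ha : 0 < α / m := by positivity
  have hfin : u ^ 2 ≤ 3 / 2 * (k * lam / (α / m)) * u + 2 * (k * lam / (α / m)) * b
      + (m - 1) * b ^ 2 := by
    generalize α / m = a at *
    have h1 : a * (l2norm Δ) ^ 2 ≤ lam * (3 / 2 * u + 2 * b) + (m - 1) * a / k * b ^ 2 := by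
      linarith
    have h2 : k / a * (a * (l2norm Δ) ^ 2)
        ≤ k / a * (lam * (3 / 2 * u + 2 * b) + (m - 1) * a / k * b ^ 2) :=
      mul_le_mul_of_nonneg_left h1 (by positivity)
    have h3 : k / a * (a * (l2norm Δ) ^ 2) = k * (l2norm Δ) ^ 2 := by field_simp
    have h4 : k / a * (lam * (3 / 2 * u + 2 * b) + (m - 1) * a / k * b ^ 2)
        = 3 / 2 * (k * lam / a) * u + 2 * (k * lam / a) * b + (m - 1) * b ^ 2 := by
      field_simp
    linarith
  have hub := lasso_scalar hu0 hb0 (by positivity) hm hfin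
  have hgoal : 2 * lam * (u + b) ≤ 20 * (k * lam ^ 2) / (α / m)
        + (8 * Real.sqrt (2 * m) + 18) * lam * b := by
    have h1 := mul_le_mul_of_nonneg_left hub (by positivity : 0 ≤ 2 * lam)
    have h2 : 20 * (k * lam ^ 2) / (α / m) = 2 * lam * (10 * (k * lam / (α / m))) := by
      ring
    rw [h2]
    linarith
  rw [← hb, hdiff]
  refine le_trans ?_ hgoal
  rw [abs_le]
  have p1 := mul_nonneg hlam.le hu0
  have p2 := mul_nonneg hlam.le hv0
  have p3 := mul_nonneg hlam.le hb0
  have p4 := mul_le_mul_of_nonneg_left hcone hlam.le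
  constructor <;> linarith
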